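/- A language L ⊆ Σ* is accepted by a total alternating Turing machine if and only if both L and its complement Σ* ∖ L are accepted by alternating Turing machines. -/

import Mathlib

namespace ATMPaper

/-- Actions of a Turing machine: overwrite the scanned symbol by a letter,
move the cursor backward (`left`), or forward (`right`). -/
inductive Act (Γ : Type) : Type
  | write : Γ → Act Γ
  | left : Act Γ
  | right : Act Γ

/-- A cursored tape `u γ̲ v`: the string `u` to the left of the cursor,
the scanned symbol `γ`, and the string `v` to the right. -/
abbrev Tape (Γ : Type) : Type := List Γ × Γ × List Γ

/-- The scanned symbol of a cursored tape. -/
def Tape.scan {Γ : Type} (t : Tape Γ) : Γ := t.2.1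

/-- The effect of an action on a cursored tape (with blank symbol `blank`):
moving forward past the right end extends the tape with a blank, and moving
backward at the left end leaves the cursor in place. -/
inductive ActStep {Γ : Type} (blank : Γ) : Act Γ → Tape Γ → Tape Γ → Prop
  | fwd (u : List Γ) (γ τ : Γ) (v : List Γ) :
      ActStep blank Act.right (u, γ, τ :: v) (u ++ [γ], τ, v)
  | fwdEnd (u : List Γ) (γ : Γ) :
      ActStep blank Act.right (u, γ, []) (u ++ [γ], blank, [])
  | bwd (u : List Γ) (τ γ : Γ) (v : List Γ) :
      ActStep blank Act.left (u ++ [τ], γ, v) (u, τ, γ :: v)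
  | bwdEnd (γ : Γ) (v : List Γ) :
      ActStep blank Act.left ([], γ, v) ([], γ, v)
  | write (u : List Γ) (γ τ : Γ) (v : List Γ) :
      ActStep blank (Act.write τ) (u, γ, v) (u, τ, v)

section Generic

variable {C : Type*} (isE : C → Bool) (step : C → C → Prop)

/-- A chain of steps `c = c₀ → ⋯ → cₙ = c'` (`n ≥ 0`) in which `c₀,…,cₙ₋₁`
are all existential. -/
inductive EChain : C → C → Prop
  | refl (c : C) : EChain c c
  | step {c c' c'' : C} : isE c = true → step c c' → EChain c' c'' → EChain c c''

/-- A chain of steps `c = c₀ → ⋯ → cₙ = c'` (`n ≥ 0`) in which `c₀,…,cₙ₋₁`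
are all universal. -/
inductive UChain : C → C → Prop
  | refl (c : C) : UChain c c
  | step {c c' c'' : C} : isE c = false → step c c' → UChain c' c'' → UChain c c''

/-- `c ⇑∃ c'` : `c'` is universal and reachable from `c` by a chain passing
only through existential configurations. -/
def EPivot (c c' : C) : Prop := EChain isE step c c' ∧ isE c' = false

/-- `c ⇑∀ c'` : `c'` is existential and reachable from `c` by a chain passing
only through universal configurations. -/
def UPivot (c c' : C) : Prop := UChain isE step c c' ∧ isE c' = true

/-- The set `AC` of accepted configurations: the least set `S` such that
(i) an existential `c` with some pivot `c ⇑∃ c'`, `c' ∈ S`, is in `S`, and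
(ii) a universal `c` all of whose pivots `c ⇑∀ c'` lie in `S` is in `S`. -/
inductive Accepted : C → Prop
  | ex {c c' : C} : isE c = true → EPivot isE step c c' → Accepted c' → Accepted c
  | univ {c : C} : isE c = false → (∀ c', UPivot isE step c c' → Accepted c') →
      Accepted c

/-- The set `RC` of rejected configurations: the least set `S` such that
(i) an existential `c` all of whose pivots `c ⇑∃ c'` lie in `S` is in `S`, and
(ii) a universal `c` with some pivot `c ⇑∀ c'`, `c' ∈ S`, is in `S`. -/
inductive Rejected : C → Prop
  | ex {c : C} : isE c = true → (∀ c', EPivot isE step c c' → Rejected c') →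
      Rejected c
  | univ {c c' : C} : isE c = false → UPivot isE step c c' → Rejected c' →
      Rejected c

end Generic

/-- An alternating Turing machine over input alphabet `α`, with (finite)
machine alphabet `Γ` into which `α` embeds, a blank symbol (not a letter
of `α`), a finite set `Q` of states each of which is existential
(`isE q = true`) or universal (`isE q = false`), a start state, and a
transition relation `δ`. -/
structure ATM (α Γ : Type) where
  ΓFin : Finite Γ
  emb : α ↪ Γ
  blank : Γ
  blank_ne : ∀ a : α, emb a ≠ blank
  Q : Type
  QFin : Finite Q
  isE : Q → Bool
  start : Q
  δ : Q → Γ → Act Γ → Q → Prop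

namespace ATM

variable {α Γ : Type} (M : ATM α Γ)

/-- A configuration: a state together with a cursored tape. -/
abbrev Cfg : Type := M.Q × Tape Γ

/-- A configuration is existential or universal according to its state. -/
def cfgE (c : M.Cfg) : Bool := M.isE c.1

/-- The one-step yield relation between configurations. -/
def Yield (c c' : M.Cfg) : Prop :=
  ∃ a : Act Γ, M.δ c.1 (Tape.scan c.2) a c'.1 ∧ ActStep M.blank a c.2 c'.2

/-- `c ⇑∃ c'` for configurations of `M`. -/
def EPiv (c c' : M.Cfg) : Prop := ATMPaper.EPivot M.cfgE M.Yield c c'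

/-- `c ⇑∀ c'` for configurations of `M`. -/
def UPiv (c c' : M.Cfg) : Prop := ATMPaper.UPivot M.cfgE M.Yield c c'

/-- `c` is an accepted configuration of `M`. -/
def Accepted (c : M.Cfg) : Prop := ATMPaper.Accepted M.cfgE M.Yield c

/-- `c` is a rejected configuration of `M`. -/
def Rejected (c : M.Cfg) : Prop := ATMPaper.Rejected M.cfgE M.Yield c

/-- The initial configuration `(s₀, ε, ⊔, w)` for input `w`. -/
def init (w : List α) : M.Cfg := (M.start, ([], M.blank, w.map M.emb))

/-- `M` accepts the input string `w`. -/
def Accepts (w : List α) : Prop := M.Accepted (M.init w)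

/-- `M` rejects the input string `w`. -/
def Rejects (w : List α) : Prop := M.Rejected (M.init w)

/-- The language `L(M)` accepted by `M`. -/
def Lang : Set (List α) := {w | M.Accepts w}

/-- The language `L̄(M)` rejected by `M`. -/
def coLang : Set (List α) := {w | M.Rejects w}

/-- `M` is total: every input is either accepted or rejected. -/
def Total : Prop := ∀ w : List α, M.Accepts w ∨ M.Rejects w

/-- `M` is one-sided: it has no accepted configurations, or no rejected ones. -/
def OneSided : Prop :=
  (∀ c : M.Cfg, ¬ M.Accepted c) ∨ (∀ c : M.Cfg, ¬ M.Rejected c)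

/-- The dual machine: same data, with existential and universal states
interchanged. -/
def dual : ATM α Γ :=
  ⟨M.ΓFin, M.emb, M.blank, M.blank_ne, M.Q, M.QFin,
    fun q => !M.isE q, M.start, M.δ⟩

/-- `M` is alternation well-founded: for no input `w` is there an infinite
sequence of yield-steps from the initial configuration for `w` in which the
type (existential/universal) changes infinitely often. -/
def AltWF : Prop :=
  ∀ w : List α, ¬∃ d : ℕ → M.Cfg, d 0 = M.init w ∧
    (∀ i : ℕ, M.Yield (d i) (d (i + 1))) ∧
    (∀ n : ℕ, ∃ m : ℕ, n ≤ m ∧ M.cfgE (d m) ≠ M.cfgE (d (m + 1)))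

/-- Every chain of yield-steps from an initial configuration of `M` has at
most `k` alternation-pivots, i.e. at most `k` indices at which the type of
the configuration changes. -/
def AltBound (k : ℕ) : Prop :=
  ∀ (w : List α) (n : ℕ) (d : ℕ → M.Cfg), d 0 = M.init w →
    (∀ i < n, M.Yield (d i) (d (i + 1))) →
    ((Finset.range n).filter fun i => M.cfgE (d i) ≠ M.cfgE (d (i + 1))).card ≤ k

/-- `M` is a `Σ_k` machine: its start state is existential and every chain of
yield-steps from an initial configuration has at most `k` alternation-pivots. -/
def IsSigmaM (k : ℕ) : Prop := M.isE M.start = true ∧ M.AltBound k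

/-- `M` is a `Π_k` machine: its start state is universal and every chain of
yield-steps from an initial configuration has at most `k` alternation-pivots;
moreover for `k = 1` no transition rule applies to any existential state. -/
def IsPiM (k : ℕ) : Prop :=
  M.isE M.start = false ∧ M.AltBound k ∧
    (k = 1 → ∀ (q : M.Q) (γ : Γ) (a : Act Γ) (q' : M.Q),
      M.δ q γ a q' → M.isE q = false)

end ATM

/-- `AltQuant α k b P` is the statement `Q₁ x₁ Q₂ x₂ ⋯ Q_k x_k, P (x₁,…,x_k)`
where the quantifiers `Qᵢ` over `List α` alternate, starting with `∃` if
`b = true` and with `∀` if `b = false`. -/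
def AltQuant (α : Type) : (k : ℕ) → Bool → ((Fin k → List α) → Prop) → Prop
  | 0, _, P => P fun i => i.elim0
  | k + 1, true, P => ∃ x : List α, AltQuant α k false fun v => P (Fin.cons x v)
  | k + 1, false, P => ∀ x : List α, AltQuant α k true fun v => P (Fin.cons x v)

/-- `L ⊆ Σ*` is `Σ⁰_k`: definable by `k` alternating quantifiers over strings,
beginning with `∃`, applied to a computable relation. -/
def IsSigma0 (α : Type) [Primcodable α] (k : ℕ) (L : Set (List α)) : Prop :=
  ∃ R : List α × (Fin k → List α) → Prop, ComputablePred R ∧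
    L = {w | AltQuant α k true fun v => R (w, v)}

/-- `L ⊆ Σ*` is `Π⁰_k`: definable by `k` alternating quantifiers over strings,
beginning with `∀`, applied to a computable relation. -/
def IsPi0 (α : Type) [Primcodable α] (k : ℕ) (L : Set (List α)) : Prop :=
  ∃ R : List α × (Fin k → List α) → Prop, ComputablePred R ∧
    L = {w | AltQuant α k false fun v => R (w, v)}

/-- `L ⊆ Σ*` is inductive (`Π¹₁`): there is a computable relation
`R ⊆ Σ* × List (Σ*)` with
`L = {w | ∀ f : ℕ → Σ*, ∃ n, R (w, [f 0, …, f n])}`. -/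
def IsInductive (α : Type) [Primcodable α] (L : Set (List α)) : Prop :=
  ∃ R : List α × List (List α) → Prop, ComputablePred R ∧
    L = {w | ∀ f : ℕ → List α, ∃ n : ℕ, R (w, (List.range (n + 1)).map f)}

/-- A two-tape alternating Turing machine: as `ATM`, but configurations carry
two cursored tapes, and transitions read both scanned symbols and perform an
action on each tape. -/
structure ATM2 (α Γ : Type) where
  ΓFin : Finite Γ
  emb : α ↪ Γ
  blank : Γ
  blank_ne : ∀ a : α, emb a ≠ blank
  Q : Type
  QFin : Finite Q
  isE : Q → Bool
  start : Q
  δ : Q → Γ → Γ → Act Γ → Act Γ → Q → Prop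

namespace ATM2

variable {α Γ : Type} (M : ATM2 α Γ)

/-- A configuration of a two-tape machine: a state and two cursored tapes. -/
abbrev Cfg : Type := M.Q × Tape Γ × Tape Γ

/-- A configuration is existential or universal according to its state. -/
def cfgE (c : M.Cfg) : Bool := M.isE c.1

/-- The one-step yield relation of a two-tape machine. -/
def Yield (c c' : M.Cfg) : Prop :=
  ∃ a₀ a₁ : Act Γ, M.δ c.1 (Tape.scan c.2.1) (Tape.scan c.2.2) a₀ a₁ c'.1 ∧
    ActStep M.blank a₀ c.2.1 c'.2.1 ∧ ActStep M.blank a₁ c.2.2 c'.2.2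

/-- `c ⇑∃ c'` for configurations of `M`. -/
def EPiv (c c' : M.Cfg) : Prop := ATMPaper.EPivot M.cfgE M.Yield c c'

/-- `c ⇑∀ c'` for configurations of `M`. -/
def UPiv (c c' : M.Cfg) : Prop := ATMPaper.UPivot M.cfgE M.Yield c c'

/-- `c` is an accepted configuration of `M`. -/
def Accepted (c : M.Cfg) : Prop := ATMPaper.Accepted M.cfgE M.Yield c

/-- `c` is a rejected configuration of `M`. -/
def Rejected (c : M.Cfg) : Prop := ATMPaper.Rejected M.cfgE M.Yield c

/-- `M` accepts `w`: the configuration reached after the (deterministic)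
pre-processing phase — the start state with the input copied onto both
tapes — is accepted. -/
def Accepts (w : List α) : Prop :=
  M.Accepted (M.start, ([], M.blank, w.map M.emb), ([], M.blank, w.map M.emb))

/-- `M` rejects `w`. -/
def Rejects (w : List α) : Prop :=
  M.Rejected (M.start, ([], M.blank, w.map M.emb), ([], M.blank, w.map M.emb))

end ATM2

/-- The combined two-tape machine `M` of two single-tape machines `M₀`, `M₁`
over a common alphabet. Its states are triples `⟨q₀,q₁,j⟩` (`j : Bool`, with
`false` for `0` and `true` for `1`), typed according to `q_j`. In control
`j = 0`, a rule `(q₀,γ₀,a,p₀)` of `M₀` acts by `a` on tape `0`, leaves tape `1`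
unchanged (re-writing its scanned symbol), and passes to control `0` if `q₀`
and `p₀` are both universal, and to control `1` otherwise; symmetrically, in
control `j = 1`, a rule `(q₁,γ₁,a,p₁)` of `M₁` acts by `a` on tape `1`, leaves
tape `0` unchanged, and passes to control `1` if `q₁` and `p₁` are both
existential, and to control `0` otherwise. -/
def combine {α Γ : Type} (M₀ M₁ : ATM α Γ) : ATM2 α Γ where
  ΓFin := M₀.ΓFin
  emb := M₀.emb
  blank := M₀.blank
  blank_ne := M₀.blank_ne
  Q := M₀.Q × M₁.Q × Bool
  QFin := by haveI := M₀.QFin; haveI := M₁.QFin; infer_instance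
  isE := fun s => cond s.2.2 (M₁.isE s.2.1) (M₀.isE s.1)
  start := (M₀.start, M₁.start, false)
  δ := fun s γ₀ γ₁ a₀ a₁ p =>
    (s.2.2 = false ∧ ∃ p₀ : M₀.Q, M₀.δ s.1 γ₀ a₀ p₀ ∧ a₁ = Act.write γ₁ ∧
        p = (p₀, s.2.1, !(!(M₀.isE s.1) && !(M₀.isE p₀)))) ∨
    (s.2.2 = true ∧ ∃ p₁ : M₁.Q, M₁.δ s.2.1 γ₁ a₁ p₁ ∧ a₀ = Act.write γ₀ ∧
        p = (s.1, p₁, M₁.isE s.2.1 && M₁.isE p₁))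

end ATMPaper

namespace ATMPaper

section Generic

variable {C : Type*} {isE : C → Bool} {step : C → C → Prop}

theorem UChain.eq_of_isE {c c' : C} (h : UChain isE step c c') (hc : isE c = true) :
    c' = c := by
  cases h with
  | refl => rfl
  | step h _ _ => simp [hc] at h

theorem Accepted.of_step {c c' : C} (hc : isE c = true) (hs : step c c')
    (ha : Accepted isE step c') : Accepted isE step c := by
  cases ha with
  | ex _ hp ha => exact .ex hc ⟨.step hc hs hp.1, hp.2⟩ ha
  | univ h hp => exact .ex hc ⟨.step hc hs (.refl _), h⟩ (.univ h hp)

theorem Accepted.of_uChain {c c' : C} (ha : Accepted isE step c)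
    (h : UChain isE step c c') (hc' : isE c' = true) : Accepted isE step c' := by
  cases hc : isE c with
  | true => exact (h.eq_of_isE hc) ▸ ha
  | false =>
    cases ha with
    | ex h' => simp [hc] at h'
    | univ _ hp => exact hp _ ⟨h, hc'⟩

theorem Accepted.of_forall_step {c : C} (hc : isE c = false)
    (h : ∀ c', step c c' → Accepted isE step c') : Accepted isE step c := by
  refine .univ hc fun c' ⟨hch, hc'⟩ => ?_
  cases hch with
  | refl => simp [hc] at hc'
  | step _ hs hch => exact (h _ hs).of_uChain hch hc'

theorem Accepted.not_rejected {c : C} (h : Accepted isE step c) :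
    ¬ Rejected isE step c := by
  induction h with
  | ex hc hp _ ih =>
    intro hr
    cases hr with
    | ex _ h => exact ih (h _ hp)
    | univ h => simp [hc] at h
  | univ hc _ ih =>
    intro hr
    cases hr with
    | ex h => simp [hc] at h
    | univ _ hp h => exact ih _ hp h

theorem eChain_not_iff {c c' : C} :
    EChain (fun x => !isE x) step c c' ↔ UChain isE step c c' := by
  constructor
  · intro h
    induction h with
    | refl => exact .refl _
    | step h hs _ ih => exact .step (by simpa using h) hs ih
  · intro h
    induction h with
    | refl => exact .refl _
    | step h hs _ ih => exact .step (by simpa using h) hs ih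

theorem uChain_not_iff {c c' : C} :
    UChain (fun x => !isE x) step c c' ↔ EChain isE step c c' := by
  simpa using (eChain_not_iff (isE := fun x => !isE x) (step := step) (c := c) (c' := c')).symm

/-- Exchanging the types of all configurations exchanges acceptance and rejection. -/
theorem accepted_not_iff {c : C} :
    Accepted (fun x => !isE x) step c ↔ Rejected isE step c := by
  constructor
  · intro h
    induction h with
    | ex hc hp _ ih =>
      exact .univ (by simpa using hc) ⟨eChain_not_iff.1 hp.1, by simpa using hp.2⟩ ih
    | univ hc _ ih =>
      exact .ex (by simpa using hc) fun c' hp =>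
        ih c' ⟨uChain_not_iff.2 hp.1, by simpa using hp.2⟩
  · intro h
    induction h with
    | ex hc _ ih =>
      exact .univ (by simpa using hc) fun c' hp =>
        ih c' ⟨uChain_not_iff.1 hp.1, by simpa using hp.2⟩
    | univ hc hp _ ih =>
      exact .ex (by simpa using hc) ⟨eChain_not_iff.2 hp.1, by simpa using hp.2⟩ ih

/-- Acceptance is transferred along type-preserving stuttering bisimulations. -/
theorem Accepted.of_stuttering {D : Type*} {isE' : D → Bool} {step' : D → D → Prop}
    {rep : C → D → Prop} (htype : ∀ x d, rep x d → isE x = isE' d)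
    (hforth : ∀ x x' d, rep x d → step x x' → rep x' d ∨ ∃ d', step' d d' ∧ rep x' d')
    (hback : ∀ x d d', rep x d → step' d d' → ∃ x₁ x',
      Relation.ReflTransGen (fun a b => step a b ∧ rep a d) x x₁ ∧ rep x₁ d ∧
        step x₁ x' ∧ rep x' d')
    {d : D} (ha : Accepted isE' step' d) : ∀ {x : C}, rep x d → Accepted isE step x := by
  induction ha with
  | @ex d d' hd hp ha ih =>
    obtain ⟨hch, hd'⟩ := hp
    clear hd ha
    induction hch with
    | refl => exact ih
    | step hd hs _ ih' =>
      intro x hx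
      obtain ⟨x₁, x', hr, hx₁, hxs, hx'⟩ := hback _ _ _ hx hs
      have h₁ : Accepted isE step x₁ :=
        .of_step ((htype _ _ hx₁).trans hd) hxs (ih' @ih hd' hx')
      clear hx
      induction hr using Relation.ReflTransGen.head_induction_on with
      | refl => exact h₁
      | head h _ ih₂ => exact .of_step ((htype _ _ h.2).trans hd) h.1 ih₂
  | @univ d hd ha ih =>
    intro x hx
    refine .univ ((htype _ _ hx).trans hd) fun x' hp => ?_
    obtain ⟨hch, hx'⟩ := hp
    have key : ∃ d', UChain isE' step' d d' ∧ rep x' d' := by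
      clear hd ih ha
      induction hch generalizing d with
      | refl => exact ⟨d, .refl _, hx⟩
      | step hc hs _ ih =>
        rcases hforth _ _ _ hx hs with h | ⟨d₁, hd₁, h⟩
        · exact ih h hx'
        · obtain ⟨d', h₁, h₂⟩ := ih h hx'
          exact ⟨d', .step ((htype _ _ hx).symm.trans hc) hd₁ h₁, h₂⟩
    obtain ⟨d', h₁, h₂⟩ := key
    exact ih d' ⟨h₁, (htype _ _ h₂).symm.trans hx'⟩ h₂

end Generic

section Interleave

variable {C : Bool → Type*} (isE : ∀ j, C j → Bool) (step : ∀ j, C j → C j → Prop)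

/-- The type of a configuration of the interleaving of two systems. System `true` is played
as given, whereas in system `false` the two players exchange their roles. -/
def interE (d : (∀ j, C j) × Bool) : Bool := isE d.2 (d.1 d.2) == d.2

/-- One step of the interleaving of two systems: the system in control makes a step, and
control is handed over unless the step is between universal configurations. -/
def InterStep (d d' : (∀ j, C j) × Bool) : Prop :=
  ∃ x, step d.2 (d.1 d.2) x ∧
    d' = (Function.update d.1 d.2 x,
      if isE d.2 (d.1 d.2) = false ∧ isE d.2 x = false then d.2 else !d.2)

variable {isE step}

theorem accepted_interleave_other {j : Bool} {c : ∀ j, C j}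
    (hP : ∀ y, ¬ Accepted (isE (!j)) (step (!j)) y →
      Accepted (fun d => interE isE d == j) (InterStep isE step)
        (Function.update c (!j) y, j))
    (hc : ¬ Accepted (isE (!j)) (step (!j)) (c !j)) :
    Accepted (fun d => interE isE d == j) (InterStep isE step) (c, !j) := by
  cases hy : isE (!j) (c !j) with
  | true =>
    refine .of_forall_step (by simp [interE, hy]) ?_
    rintro _ ⟨x, hx, rfl⟩
    have := hP x fun h => hc (.of_step hy hx h)
    simpa [hy] using this
  | false =>
    have hex : ∃ y, UPivot (isE (!j)) (step (!j)) (c !j) y ∧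
        ¬ Accepted (isE (!j)) (step (!j)) y := by
      by_contra! h
      exact hc (.univ hy h)
    obtain ⟨y, ⟨hch, hyE⟩, hy'⟩ := hex
    clear hc
    generalize hz : c (!j) = z at hch hy
    induction hch generalizing c with
    | refl => simp [hy] at hyE
    | @step z z₁ y hzE hs hch ih =>
      subst hz
      refine .of_step (c' := (Function.update c (!j) z₁,
        if isE (!j) (c !j) = false ∧ isE (!j) z₁ = false then !j else !!j))
        (by simp [interE, hy]) ⟨z₁, hs, rfl⟩ ?_
      cases hz₁ : isE (!j) z₁ with
      | true =>
        have := hch.eq_of_isE hz₁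
        subst this
        simpa [hy] using hP y hy'
      | false =>
        simpa [hy] using ih (c := Function.update c (!j) z₁) (by simpa using hP) hy' hyE
          (by simp) hz₁

/-- If `j` wins system `j` and the opponent does not win the other system, then `j` wins the
interleaving. -/
theorem accepted_interleave {j : Bool} {x : C j} (hx : Accepted (isE j) (step j) x) :
    ∀ {c : ∀ j, C j}, c j = x → ¬ Accepted (isE (!j)) (step (!j)) (c !j) →
      Accepted (fun d => interE isE d == j) (InterStep isE step) (c, j) := by
  have hne : j ≠ !j := by cases j <;> simp
  induction hx with
  | @ex x x' hx hp ha ih =>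
    obtain ⟨hch, hx'⟩ := hp
    clear hx ha
    induction hch with
    | refl => exact @ih
    | @step x x₁ x' hx hs _ ih' =>
      rintro c rfl hc
      refine .of_step (c' := (Function.update c j x₁,
        if isE j (c j) = false ∧ isE j x₁ = false then j else !j))
        (by cases j <;> simp [interE, hx]) ⟨x₁, hs, rfl⟩ ?_
      simp only [hx, Bool.true_eq_false, false_and, if_false]
      refine accepted_interleave_other (fun y hy => ih' @ih hx' ?_ ?_) ?_
      · simp [hne]
      · simpa using hy
      · simpa [hne.symm] using hc
  | @univ x hx ha ih =>
    clear ha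
    rintro c rfl hc
    refine .univ (by cases j <;> simp [interE, hx]) ?_
    rintro d ⟨hch, hd⟩
    generalize hk : (c, j) = k at hch
    induction hch generalizing c with
    | refl => subst hk; cases j <;> simp [interE, hx] at hd
    | @step k k₁ d _ hs hch ih' =>
      subst hk
      obtain ⟨x₁, hs, rfl⟩ := hs
      cases hx₁ : isE j x₁ with
      | false =>
        refine ih' (c := Function.update c j x₁) ?_ ?_ ?_ hd ?_
        · simpa using hx₁
        · intro y hy
          exact @ih y ⟨.step hx hs (by simpa using hy.1), hy.2⟩
        · simpa [hne.symm] using hc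
        · simp [hx, hx₁]
      | true =>
        refine Accepted.of_uChain ?_ hch hd
        simp only [hx₁, Bool.true_eq_false, and_false, if_false]
        refine accepted_interleave_other
          (fun y hy => ih x₁ ⟨.step hx hs (.refl _), hx₁⟩ ?_ ?_) ?_
        · simp [hne]
        · simpa using hy
        · simpa [hne.symm] using hc

end Interleave

section Tapes

variable {Γ : Type}

/-- The position of the cursor on a tape. -/
def Tape.pos (T : Tape Γ) : ℕ := T.1.length

/-- The symbol in the `i`-th cell of a tape, blank beyond the right end. -/
def Tape.cell (b : Γ) (T : Tape Γ) (i : ℕ) : Γ := (T.1 ++ T.2.1 :: T.2.2)[i]?.getD b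

/-- The effect of an action on the cursor position. -/
def Act.newPos : Act Γ → ℕ → ℕ
  | .write _, n => n
  | .left, n => n - 1
  | .right, n => n + 1

/-- The effect of an action on the scanned symbol. -/
def Act.newSymbol : Act Γ → Γ → Γ
  | .write τ, _ => τ
  | .left, γ => γ
  | .right, γ => γ

theorem Tape.cell_pos (b : Γ) (T : Tape Γ) : T.cell b T.pos = T.scan := by
  simp [Tape.cell, Tape.pos, Tape.scan]

theorem ActStep.pos_eq {b : Γ} {a : Act Γ} {T T' : Tape Γ} (h : ActStep b a T T') :
    T'.pos = a.newPos T.pos := by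
  cases h <;> simp [Tape.pos, Act.newPos]

theorem ActStep.cell_eq {b : Γ} {a : Act Γ} {T T' : Tape Γ} (h : ActStep b a T T') (i : ℕ) :
    T'.cell b i = if i = T.pos then a.newSymbol T.scan else T.cell b i := by
  by_cases hi : i = T.pos
  · subst hi
    cases h <;> simp [Tape.pos, Act.newSymbol, Tape.cell, Tape.scan]
  · rw [if_neg hi]
    cases h with
    | fwd u γ τ v => simp [Tape.cell]
    | fwdEnd u γ =>
      simp only [Tape.cell, Tape.pos] at hi ⊢
      rcases lt_or_gt_of_ne hi with h | h
      · simp [List.getElem?_append, h, h.trans (Nat.lt_succ_self _)]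
      · obtain ⟨m, rfl⟩ := Nat.exists_eq_add_of_lt h
        cases m <;> simp
    | bwd u τ γ v => simp [Tape.cell]
    | bwdEnd γ v => rfl
    | write u γ τ v =>
      simp only [Tape.cell, Tape.pos] at hi ⊢
      rcases lt_or_gt_of_ne hi with h | h
      · simp [List.getElem?_append, h]
      · obtain ⟨m, rfl⟩ := Nat.exists_eq_add_of_lt h
        simp [add_assoc, List.getElem?_append_right]

theorem exists_actStep (b : Γ) (a : Act Γ) (T : Tape Γ) : ∃ T', ActStep b a T T' := by
  obtain ⟨u, γ, v⟩ := T
  cases a with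
  | write τ => exact ⟨_, .write u γ τ v⟩
  | left =>
    rcases List.eq_nil_or_concat u with rfl | ⟨u, τ, rfl⟩
    · exact ⟨_, .bwdEnd γ v⟩
    · exact ⟨_, by simpa using ActStep.bwd u τ γ v⟩
  | right =>
    cases v with
    | nil => exact ⟨_, .fwdEnd u γ⟩
    | cons τ v => exact ⟨_, .fwd u γ τ v⟩

end Tapes

/-- The phases of the single-tape simulation of two interleaved machines: marking the initial
cell, marking the cell of the cursor that loses control, searching for the cursor that
receives control, and simulating a step of the machine in control. -/
inductive Phase : Type
  | start
  | drop
  | search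
  | run

theorem Phase.finite : Finite Phase := by
  refine Finite.of_surjective
    (fun p : Bool × Bool => cond p.1 (cond p.2 start drop) (cond p.2 search run)) ?_
  rintro (_ | _ | _ | _)
  exacts [⟨(true, true), rfl⟩, ⟨(true, false), rfl⟩, ⟨(false, true), rfl⟩,
    ⟨(false, false), rfl⟩]

section Parallel

variable {α : Type} {Γ : Bool → Type} (M : ∀ j, ATM α (Γ j))

/-- The tape alphabet of the parallel machine: input letters, the blank, and two tracks, each
carrying a symbol and a mark for the position of a cursor. -/
abbrev ParSymbol (α : Type) (Γ : Bool → Type) : Type := Option α ⊕ (∀ j, Γ j × Bool)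

/-- The two tracks represented by a symbol of the parallel machine. -/
def decode : ParSymbol α Γ → ∀ j, Γ j × Bool
  | .inl none => fun j => ((M j).blank, false)
  | .inl (some a) => fun j => ((M j).emb a, false)
  | .inr s => s

/-- Set or clear the mark on track `k`. -/
def setMark (k b : Bool) (s : ∀ j, Γ j × Bool) : ∀ j, Γ j × Bool :=
  Function.update s k ((s k).1, b)

/-- Perform an action on track `k`. -/
def Act.onTrack (k : Bool) (s : ∀ j, Γ j × Bool) : Act (Γ k) → Act (ParSymbol α Γ)
  | .write τ => .write (.inr (Function.update s k (τ, (s k).2)))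
  | .left => .left
  | .right => .right

/-- The transition rules of the parallel machine. In its states, the last component is the
index of the machine in control, or about to receive control. -/
inductive ParRule : (∀ j, (M j).Q) × Phase × Bool → ParSymbol α Γ → Act (ParSymbol α Γ) →
    (∀ j, (M j).Q) × Phase × Bool → Prop
  | start (q k γ) : ParRule (q, .start, k) γ
      (.write (.inr fun j => ((decode M γ j).1, true))) (q, .search, k)
  | drop (q k γ) : ParRule (q, .drop, k) γ
      (.write (.inr (setMark (!k) true (decode M γ)))) (q, .search, k)
  | left (q k γ) : ParRule (q, .search, k) γ .left (q, .search, k)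
  | right (q k γ) : ParRule (q, .search, k) γ .right (q, .search, k)
  | found (q k γ) : (decode M γ k).2 = true → ParRule (q, .search, k) γ
      (.write (.inr (setMark k false (decode M γ)))) (q, .run, k)
  | run (q k γ a p) : (M k).δ (q k) (decode M γ k).1 a p → ParRule (q, .run, k) γ
      (a.onTrack k (decode M γ))
      (Function.update q k p,
        if (M k).isE (q k) = false ∧ (M k).isE p = false then (.run, k) else (.drop, !k))

/-- A single-tape machine simulating the interleaving of two machines. -/
def parallel [Finite α] : ATM α (ParSymbol α Γ) where
  ΓFin := by
    have := fun j => (M j).ΓFin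
    infer_instance
  emb := ⟨fun a => .inl (some a), fun a b h => by simpa using h⟩
  blank := .inl none
  blank_ne := fun a h => by cases h
  Q := (∀ j, (M j).Q) × Phase × Bool
  QFin := by
    have := fun j => (M j).QFin
    have := Phase.finite
    infer_instance
  isE := fun s => (M s.2.2).isE (s.1 s.2.2) == s.2.2
  start := (fun j => (M j).start, .start, true)
  δ := ParRule M

/-- The conditions on cursor position `n` and marks `m` of the simulating tape during the
phases, for simulated tapes with cursor positions `r`. -/
def PhaseInv (k : Bool) (n : ℕ) (m : ℕ → Bool → Bool) (r : Bool → ℕ) : Phase → Prop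
  | .start => n = 0 ∧ (∀ j, r j = 0) ∧ ∀ i j, m i j = false
  | .drop => n = r (!k) ∧ ∀ i j, m i j = decide (j = k ∧ i = r j)
  | .search => ∀ i j, m i j = decide (i = r j)
  | .run => n = r k ∧ ∀ i j, m i j = decide (j ≠ k ∧ i = r j)

/-- A configuration of the parallel machine represents a configuration of the interleaving of
the two machines. -/
structure Represents (ph : Phase) (T : Tape (ParSymbol α Γ))
    (d : (∀ j, (M j).Cfg) × Bool) : Prop where
  symbol_eq : ∀ i j, (decode M (T.cell (.inl none) i) j).1 = (d.1 j).2.cell (M j).blank i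
  inv : PhaseInv d.2 T.pos (fun i j => (decode M (T.cell (.inl none) i) j).2)
    (fun j => (d.1 j).2.pos) ph

variable {M} {T T' : Tape (ParSymbol α Γ)} {d : (∀ j, (M j).Cfg) × Bool}

theorem decode_cell_write {s : ∀ j, Γ j × Bool}
    (hT : ActStep (.inl none) (.write (.inr s)) T T') (i : ℕ) :
    decode M (T'.cell (.inl none) i) =
      if i = T.pos then s else decode M (T.cell (.inl none) i) := by
  rw [hT.cell_eq]
  split_ifs <;> rfl

theorem decode_cell_setMark {k b : Bool}
    (hT : ActStep (.inl none) (.write (.inr (setMark k b (decode M T.scan)))) T T')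
    (i : ℕ) (j : Bool) :
    decode M (T'.cell (.inl none) i) j = ((decode M (T.cell (.inl none) i) j).1,
      if i = T.pos ∧ j = k then b else (decode M (T.cell (.inl none) i) j).2) := by
  rw [decode_cell_write hT]
  by_cases hi : i = T.pos
  · subst hi
    rw [if_pos rfl, Tape.cell_pos]
    by_cases hj : j = k
    · subst hj
      simp [setMark]
    · simp [setMark, hj]
  · simp [hi]

theorem Represents.start (h : Represents M .start T d)
    (hT : ActStep (.inl none) (.write (.inr fun j => ((decode M T.scan j).1, true))) T T') :
    Represents M .search T' d := by
  obtain ⟨h₁, h₂, h₃, h₄⟩ := h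
  refine ⟨fun i j => ?_, fun i j => ?_⟩
  · rw [← h₁ i j, decode_cell_write hT]
    split_ifs with hi
    · rw [hi, Tape.cell_pos]
    · rfl
  · have h₃' := h₃ j
    have h₄' := h₄ i j
    dsimp only at *
    rw [decode_cell_write hT, h₂]
    split_ifs with hi
    · simp [hi, h₃']
    · simp [h₄', hi, h₃']

theorem Represents.drop (h : Represents M .drop T d)
    (hT : ActStep (.inl none)
      (.write (.inr (setMark (!d.2) true (decode M T.scan)))) T T') :
    Represents M .search T' d := by
  obtain ⟨h₁, h₂, h₃⟩ := h
  refine ⟨fun i j => ?_, fun i j => ?_⟩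
  · rw [← h₁ i j, decode_cell_setMark hT]
  · have h₃' := h₃ i j
    dsimp only at *
    rw [decode_cell_setMark hT, h₃', h₂]
    by_cases hj : j = !d.2
    · subst hj
      simp
    · have hj' : j = d.2 := by simpa [Bool.eq_not_iff] using hj
      simp [hj']

theorem Represents.move {a : Act (ParSymbol α Γ)} (ha : ∀ γ, a.newSymbol γ = γ)
    (h : Represents M .search T d) (hT : ActStep (.inl none) a T T') :
    Represents M .search T' d := by
  have hc : ∀ i, T'.cell (.inl none) i = T.cell (.inl none) i := by
    intro i
    rw [hT.cell_eq]
    split_ifs with hi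
    · rw [ha, hi, Tape.cell_pos]
    · rfl
  exact ⟨by simpa only [hc] using h.symbol_eq, by simpa only [hc] using! h.inv⟩

theorem Represents.mark_iff (h : Represents M .search T d) (j : Bool) :
    (decode M T.scan j).2 = true ↔ T.pos = (d.1 j).2.pos := by
  have := h.inv T.pos j
  dsimp only at this
  rw [← Tape.cell_pos (.inl none), this, decide_eq_true_iff]

theorem Represents.found (h : Represents M .search T d)
    (hm : (decode M T.scan d.2).2 = true)
    (hT : ActStep (.inl none) (.write (.inr (setMark d.2 false (decode M T.scan)))) T T') :
    Represents M .run T' d := by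
  rw [h.mark_iff] at hm
  obtain ⟨h₁, h₂⟩ := h
  refine ⟨fun i j => ?_, hT.pos_eq.trans hm, fun i j => ?_⟩
  · rw [← h₁ i j, decode_cell_setMark hT]
  · have h₂' := h₂ i j
    dsimp only at *
    rw [decode_cell_setMark hT, h₂', hm]
    by_cases hj : j = d.2
    · subst hj
      simp
    · simp [hj]

theorem Represents.scan_eq (h : Represents M .run T d) :
    (decode M T.scan d.2).1 = (d.1 d.2).2.scan := by
  rw [← Tape.cell_pos (.inl none), h.symbol_eq, h.inv.1, Tape.cell_pos]

theorem Represents.run {a : Act (Γ d.2)} {p : (M d.2).Q} {S : Tape (Γ d.2)}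
    (h : Represents M .run T d)
    (hT : ActStep (.inl none) (a.onTrack d.2 (decode M T.scan)) T T')
    (hS : ActStep (M d.2).blank a (d.1 d.2).2 S) (ph : Phase) (k : Bool)
    (hk : ph = .run ∧ k = d.2 ∨ ph = .drop ∧ d.2 = !k) :
    Represents M ph T' (Function.update d.1 d.2 (p, S), k) := by
  have hscan := h.scan_eq
  obtain ⟨h₁, h₂, h₃⟩ := h
  obtain ⟨d, k₀⟩ := d
  dsimp only at *
  have hc := Tape.cell_pos (.inl none) T
  have hmark : ∀ i j, (decode M (T'.cell (.inl none) i) j).2 =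
      (decode M (T.cell (.inl none) i) j).2 := by
    intro i j
    rw [hT.cell_eq]
    split_ifs with hi
    · subst hi
      rw [hc]
      cases a with
      | write τ =>
        by_cases hj : j = k₀
        · subst hj
          simp [Act.onTrack, Act.newSymbol, decode]
        · simp [Act.onTrack, Act.newSymbol, decode, hj]
      | left => rfl
      | right => rfl
    · rfl
  have hpos : T'.pos = S.pos := by
    rw [hT.pos_eq, hS.pos_eq, ← h₂]
    cases a <;> rfl
  refine ⟨fun i j => ?_, ?_⟩
  · by_cases hj : j = k₀
    · subst hj
      simp only [Function.update_self, hT.cell_eq, hS.cell_eq, ← h₂]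
      split_ifs with hi
      · cases a with
        | write τ => simp [Act.onTrack, Act.newSymbol, decode]
        | left => exact hscan
        | right => exact hscan
      · exact h₁ i j
    · simp only [Function.update_of_ne hj, hT.cell_eq, ← h₁]
      split_ifs with hi
      · subst hi
        rw [hc]
        cases a with
        | write τ => simp [Act.onTrack, Act.newSymbol, decode, hj]
        | left => rfl
        | right => rfl
      · rfl
  · simp only [hmark, h₃]
    rcases hk with ⟨rfl, rfl⟩ | ⟨rfl, rfl⟩
    · refine ⟨by simpa using hpos, fun i j => ?_⟩
      by_cases hj : j = k <;> simp [hj]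
    · refine ⟨by simpa using hpos, fun i j => ?_⟩
      by_cases hj : j = k
      · simp [hj]
      · have hj' : j = !k := by simpa [Bool.eq_not_iff] using hj
        simp [hj']

/-- Representation of configurations of the interleaving of two machines by configurations of
the parallel machine. -/
inductive Rep [Finite α] : (parallel M).Cfg → (∀ j, (M j).Cfg) × Bool → Prop
  | intro {d : ∀ j, (M j).Cfg} {k : Bool} {ph : Phase} {T : Tape (ParSymbol α Γ)} :
      Represents M ph T (d, k) → Rep ((fun j => (d j).1, ph, k), T) (d, k)

variable [Finite α]

theorem Rep.cfgE_eq {x : (parallel M).Cfg} (h : Rep x d) :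
    (parallel M).cfgE x = interE (fun j => (M j).cfgE) d := by
  cases h
  rfl

theorem Represents.rep_run {d : ∀ j, (M j).Cfg} {k : Bool} {a : Act (Γ k)} {p : (M k).Q}
    {S : Tape (Γ k)} (h : Represents M .run T (d, k))
    (hT : ActStep (.inl none) (a.onTrack k (decode M T.scan)) T T')
    (hS : ActStep (M k).blank a (d k).2 S) :
    Rep (M := M) ((Function.update (fun j => (d j).1) k p,
        if (M k).isE (d k).1 = false ∧ (M k).isE p = false then (.run, k) else (.drop, !k)), T')
      (Function.update d k (p, S),
        if (M k).isE (d k).1 = false ∧ (M k).isE p = false then k else !k) := by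
  have hq : Function.update (fun j => (d j).1) k p =
      fun j => (Function.update d k (p, S) j).1 := by
    funext j
    by_cases hj : j = k
    · subst hj
      simp
    · simp [hj]
  rw [hq]
  split_ifs
  · exact .intro (h.run hT hS _ _ (.inl ⟨rfl, rfl⟩))
  · exact .intro (h.run hT hS _ _ (.inr ⟨rfl, by simp⟩))

theorem Rep.forth {x x' : (parallel M).Cfg} (h : Rep x d) (hx : (parallel M).Yield x x') :
    Rep x' d ∨ ∃ d', InterStep (fun j => (M j).cfgE) (fun j => (M j).Yield) d d' ∧
      Rep x' d' := by
  obtain ⟨s', T'⟩ := x'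
  obtain ⟨h⟩ := h
  rename_i d k ph T
  obtain ⟨a, hr, hT⟩ := hx
  cases hr with
  | start => exact .inl (.intro (h.start hT))
  | drop => exact .inl (.intro (h.drop hT))
  | left => exact .inl (.intro (h.move (fun _ => rfl) hT))
  | right => exact .inl (.intro (h.move (fun _ => rfl) hT))
  | found _ _ _ hm => exact .inl (.intro (h.found hm hT))
  | run _ _ _ a p hδ =>
    obtain ⟨S, hS⟩ := exists_actStep (M k).blank a (d k).2
    exact .inr ⟨_, ⟨(p, S), ⟨a, h.scan_eq ▸ hδ, hS⟩, rfl⟩, h.rep_run hT hS⟩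

/-- While searching, the parallel machine is able to find the cursor of the machine that is to
receive control. -/
theorem Represents.exists_found {d : ∀ j, (M j).Cfg} {k : Bool} (n : ℕ) :
    ∀ {T : Tape (ParSymbol α Γ)}, Represents M .search T (d, k) →
      (T.pos - (d k).2.pos) + ((d k).2.pos - T.pos) = n →
      ∃ T₁, Relation.ReflTransGen (fun a b => (parallel M).Yield a b ∧ Rep a (d, k))
        ((fun j => (d j).1, .search, k), T) ((fun j => (d j).1, .run, k), T₁) ∧
        Represents M .run T₁ (d, k) := by
  induction n with
  | zero =>
    intro T h hn
    have hm := (h.mark_iff k).2 (by dsimp only; omega)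
    obtain ⟨T₁, hT⟩ := exists_actStep (.inl none)
      (.write (.inr (setMark k false (decode M T.scan)))) T
    exact ⟨T₁, .single ⟨⟨_, .found _ _ _ hm, hT⟩, .intro h⟩, h.found hm hT⟩
  | succ n ih =>
    intro T h hn
    rcases lt_or_ge T.pos (d k).2.pos with hlt | hge
    · obtain ⟨T', hT⟩ := exists_actStep (.inl none) .right T
      have hp := hT.pos_eq
      simp only [Act.newPos] at hp
      obtain ⟨T₁, hr, h₁⟩ := ih (h.move (fun _ => rfl) hT) (by omega)
      refine ⟨T₁, .head ?_ hr, h₁⟩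
      exact ⟨⟨_, .right _ _ _, hT⟩, .intro h⟩
    · obtain ⟨T', hT⟩ := exists_actStep (.inl none) .left T
      have hp := hT.pos_eq
      simp only [Act.newPos] at hp
      obtain ⟨T₁, hr, h₁⟩ := ih (h.move (fun _ => rfl) hT) (by omega)
      refine ⟨T₁, .head ?_ hr, h₁⟩
      exact ⟨⟨_, .left _ _ _, hT⟩, .intro h⟩

theorem Represents.exists_run {d : ∀ j, (M j).Cfg} {k : Bool} {ph : Phase}
    (h : Represents M ph T (d, k)) :
    ∃ T₁, Relation.ReflTransGen (fun a b => (parallel M).Yield a b ∧ Rep a (d, k))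
      ((fun j => (d j).1, ph, k), T) ((fun j => (d j).1, .run, k), T₁) ∧
      Represents M .run T₁ (d, k) := by
  cases ph with
  | start =>
    obtain ⟨T', hT⟩ := exists_actStep (.inl none)
      (.write (.inr fun j => ((decode M T.scan j).1, true))) T
    obtain ⟨T₁, hr, h₁⟩ := (h.start hT).exists_found _ rfl
    refine ⟨T₁, .head ?_ hr, h₁⟩
    exact ⟨⟨_, .start _ _ _, hT⟩, .intro h⟩
  | drop =>
    obtain ⟨T', hT⟩ := exists_actStep (.inl none)
      (.write (.inr (setMark (!k) true (decode M T.scan)))) T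
    obtain ⟨T₁, hr, h₁⟩ := (h.drop hT).exists_found _ rfl
    refine ⟨T₁, .head ?_ hr, h₁⟩
    exact ⟨⟨_, .drop _ _ _, hT⟩, .intro h⟩
  | search => exact h.exists_found _ rfl
  | run => exact ⟨T, .refl, h⟩

theorem Rep.back {x : (parallel M).Cfg} (h : Rep x d) {d' : (∀ j, (M j).Cfg) × Bool}
    (hd : InterStep (fun j => (M j).cfgE) (fun j => (M j).Yield) d d') :
    ∃ x₁ x', Relation.ReflTransGen (fun a b => (parallel M).Yield a b ∧ Rep a d) x x₁ ∧
      Rep x₁ d ∧ (parallel M).Yield x₁ x' ∧ Rep x' d' := by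
  obtain ⟨h⟩ := h
  rename_i d k ph T
  obtain ⟨⟨p, S⟩, ⟨a, hδ, hS⟩, rfl⟩ := hd
  obtain ⟨T₁, hr, h₁⟩ := h.exists_run
  obtain ⟨T', hT⟩ := exists_actStep (.inl none) (a.onTrack k (decode M T₁.scan)) T₁
  exact ⟨_, (_, T'), hr, .intro h₁,
    ⟨_, .run _ _ _ a p (h₁.scan_eq.symm ▸ hδ), hT⟩, h₁.rep_run hT hS⟩

theorem rep_init (w : List α) :
    Rep ((parallel M).init w) (fun j => (M j).init w, true) := by
  have hcell : ∀ i j, decode M (((parallel M).init w).2.cell (.inl none) i) j =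
      (((M j).init w).2.cell (M j).blank i, false) := by
    intro i j
    cases i with
    | zero => rfl
    | succ i =>
      simp only [ATM.init, Tape.cell, List.nil_append, List.getElem?_cons_succ,
        List.getElem?_map]
      cases w[i]? <;> rfl
  exact Rep.intro (d := fun j => (M j).init w) (k := true) (ph := .start)
    ⟨fun i j => congrArg Prod.fst (hcell i j), rfl, fun _ => rfl,
    fun i j => congrArg Prod.snd (hcell i j)⟩

/-- If machine `j` accepts `w` and the other machine does not, then player `j` wins the
parallel machine on input `w`. -/
theorem accepted_parallel {j : Bool} {w : List α} (hj : (M j).Accepts w)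
    (hj' : ¬ (M (!j)).Accepts w) :
    Accepted (fun x => (parallel M).cfgE x == j) (parallel M).Yield ((parallel M).init w) := by
  have hwin : ∀ k, Accepted (fun d => interE (fun j => (M j).cfgE) d == j)
      (InterStep (fun j => (M j).cfgE) (fun j => (M j).Yield))
      (fun j => (M j).init w, k) := by
    have hown := fun y (hy : ¬ (M (!j)).Accepted y) =>
      accepted_interleave (isE := fun j => (M j).cfgE) (step := fun j => (M j).Yield) hj
        (c := Function.update (fun j => (M j).init w) (!j) y)
        (Function.update_of_ne (by simp) _ _) (by rw [Function.update_self]; exact hy)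
    intro k
    by_cases hk : k = j
    · subst hk
      exact accepted_interleave (isE := fun j => (M j).cfgE)
        (step := fun j => (M j).Yield) hj rfl hj'
    · obtain rfl : k = !j := by simpa [Bool.eq_not_iff] using hk
      exact accepted_interleave_other hown hj'
  refine (hwin true).of_stuttering (rep := Rep) ?_ ?_ ?_ (rep_init w)
  · intro x d h
    rw [h.cfgE_eq]
  · exact fun x x' d h hx => h.forth hx
  · exact fun x d d' h hd => h.back hd

end Parallel

theorem ATM.dual_accepts_iff {α Γ : Type} (M : ATM α Γ) (w : List α) :
    M.dual.Accepts w ↔ M.Rejects w :=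
  accepted_not_iff (isE := M.cfgE) (step := M.Yield)

end ATMPaper

open ATMPaper in
/-- a language `L ⊆ Σ*` is accepted by a total alternating
Turing machine iff both `L` and its complement `Σ* ∖ L` are accepted by
alternating Turing machines. -/
theorem stmt19 {α : Type} [Fintype α] (L : Set (List α)) :
    (∃ (Γ : Type) (M : ATM α Γ), M.Total ∧ L = M.Lang) ↔
      ((∃ (Γ : Type) (M : ATM α Γ), L = M.Lang) ∧
        (∃ (Γ : Type) (M : ATM α Γ), Lᶜ = M.Lang)) := by
  constructor
  · rintro ⟨Γ, M, hM, rfl⟩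
    refine ⟨⟨Γ, M, rfl⟩, Γ, M.dual, ?_⟩
    ext w
    change ¬ M.Accepts w ↔ M.dual.Accepts w
    rw [M.dual_accepts_iff]
    exact ⟨(hM w).resolve_left, fun hr ha => Accepted.not_rejected ha hr⟩
  · rintro ⟨⟨Γ₀, M₀, h₀⟩, Γ₁, M₁, h₁⟩
    let Γ : Bool → Type := fun j => cond j Γ₀ Γ₁
    let M : ∀ j, ATM α (Γ j) := fun
      | true => M₀
      | false => M₁
    have hM₀ : ∀ w, w ∈ L ↔ (M true).Accepts w := fun w => by rw [h₀]; rfl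
    have hM₁ : ∀ w, w ∉ L ↔ (M false).Accepts w := fun w => by
      rw [← Set.mem_compl_iff, h₁]; rfl
    have hacc : ∀ w, w ∈ L → (parallel M).Accepts w := fun w hw => by
      simpa using! accepted_parallel (j := true) ((hM₀ w).1 hw) fun h => (hM₁ w).2 h hw
    have hrej : ∀ w, w ∉ L → (parallel M).Rejects w := fun w hw =>
      accepted_not_iff.1 (by
        simpa using! accepted_parallel (j := false) ((hM₁ w).1 hw) fun h => hw ((hM₀ w).2 h))
    refine ⟨_, parallel M, fun w => ?_, ?_⟩
    · by_cases hw : w ∈ L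
      · exact .inl (hacc w hw)
      · exact .inr (hrej w hw)
    · ext w
      refine ⟨hacc w, fun h => ?_⟩
      by_contra hw
      exact Accepted.not_rejected h (hrej w hw)
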